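/- Let c be any (2n,1)-coloring of the split graph G(f). Then every color class of c contains exactly two vertices of the clique U, and moreover whenever u, u' ∈ U satisfy c(u) = c(u'), the vertices u and u' belong to the same quadruple U_i = {u_i^A, u_i^B, u_i^C, u_i^D} for some i. -/

import Mathlib

/-- The deficiency of a vertex `v` under a coloring `c`: the number of neighbors
of `v` whose color equals `c v`. -/
noncomputable def deficiency {V α : Type*} (G : SimpleGraph V) (c : V → α) (v : V) : ℕ :=
  {w | G.Adj v w ∧ c w = c v}.ncard

/-- `c` is a `(C,D)`-coloring (with colors `Fin C`): every vertex has at most `D`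
neighbors of its own color. -/
def IsDefColoring {V α : Type*} (G : SimpleGraph V) (D : ℕ) (c : V → α) : Prop :=
  ∀ v, deficiency G c v ≤ D

/-- A 3CNF formula with `n` variables and `m` clauses: each clause `j` consists of three
literals `lit j 0, lit j 1, lit j 2`, a literal being a pair of a variable index and a
Boolean (`true` for a positive occurrence), over pairwise distinct variables. -/
structure CNF3 (n m : ℕ) where
  lit : Fin m → Fin 3 → Fin n × Bool
  distinct : ∀ j : Fin m, Function.Injective (fun a => (lit j a).1)

/-- `s` satisfies `f`: every clause contains a literal made true by `s`. -/
def CNF3.Satisfies {n m : ℕ} (f : CNF3 n m) (s : Fin n → Bool) : Prop :=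
  ∀ j : Fin m, ∃ a : Fin 3, s (f.lit j a).1 = (f.lit j a).2

/-- Vertices of the split graph `G(f)`: clique vertices `u_i^k` (`k ∈ {A,B,C,D}` encoded
as `Fin 4` with `A=0, B=1, C=2, D=3`), and independent-set vertices `z_i^k` and `v_j`. -/
abbrev SatVtx (n m : ℕ) := (Fin n × Fin 4) ⊕ ((Fin n × Fin 4) ⊕ Fin m)

/-- The edges of `G(f)`, oriented from the clique side: `U` is a clique, `Z` is
independent; all `U`–`Z` edges are present except that `z_i^k` is non-adjacent to
`u_i^{kᵒ}` for `kᵒ ≠ k`, and `v_j` is non-adjacent to `u_i^A, u_i^B` (resp.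
`u_i^A, u_i^C`) when `x_i` occurs positively (resp. negatively) in clause `j`. -/
def satRel {n m : ℕ} (f : CNF3 n m) : SatVtx n m → SatVtx n m → Prop
  | Sum.inl _, Sum.inl _ => True
  | Sum.inl (i, k), Sum.inr (Sum.inl (iz, kz)) => i ≠ iz ∨ k = kz
  | Sum.inl (i, k), Sum.inr (Sum.inr j) =>
      ¬ ∃ a : Fin 3, (f.lit j a).1 = i ∧
        (((f.lit j a).2 = true ∧ (k = 0 ∨ k = 1)) ∨
         ((f.lit j a).2 = false ∧ (k = 0 ∨ k = 2)))
  | Sum.inr _, _ => False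

/-- The split graph `G(f)`. -/
def satGraph {n m : ℕ} (f : CNF3 n m) : SimpleGraph (SatVtx n m) :=
  SimpleGraph.fromRel (satRel f)

/-- In a coloring of defect one, a vertex has at most one neighbor of its own color. -/
theorem IsDefColoring.eq_of_adj {V α : Type*} [Finite V] {G : SimpleGraph V} {c : V → α}
    (hc : IsDefColoring G 1 c) {v w w' : V} (h : G.Adj v w) (h' : G.Adj v w')
    (hw : c w = c v) (hw' : c w' = c v) : w = w' :=
  (Set.ncard_le_one (Set.toFinite _)).1 (hc v) w ⟨h, hw⟩ w' ⟨h', hw'⟩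

/-- If every fiber of a map has at most `d` elements and the domain has `d` times as many
elements as the codomain, then every fiber has exactly `d` elements. -/
theorem card_fiber_eq_of_le {α β : Type*} [Fintype α] [Fintype β] [DecidableEq β]
    {g : α → β} {d : ℕ} (hcard : Fintype.card α = Fintype.card β * d)
    (hle : ∀ b, (Finset.univ.filter fun x => g x = b).card ≤ d) (b : β) :
    (Finset.univ.filter fun x => g x = b).card = d := by
  have hsum : ∑ b, (Finset.univ.filter fun x => g x = b).card = ∑ _b : β, d := by
    rw [← Finset.card_eq_sum_card_fiberwise (fun _ _ => Finset.mem_coe.2 (Finset.mem_univ _))]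
    simpa using hcard
  exact (Finset.sum_eq_sum_iff_of_le fun b _ => hle b).1 hsum b (Finset.mem_univ b)

theorem satGraph_adj_inl_inl {n m : ℕ} (f : CNF3 n m) {u v : Fin n × Fin 4} (h : u ≠ v) :
    (satGraph f).Adj (Sum.inl u) (Sum.inl v) := by
  simp [satGraph, satRel, h]

theorem satGraph_adj_inl_inr_inl {n m : ℕ} (f : CNF3 n m) {i j : Fin n} {k l : Fin 4}
    (h : i ≠ j ∨ k = l) :
    (satGraph f).Adj (Sum.inl (i, k)) (Sum.inr (Sum.inl (j, l))) := by
  simp [satGraph, satRel, h]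

section Coloring

variable {n m : ℕ} {f : CNF3 n m}

/-- Three clique vertices of the same color are not pairwise distinct. -/
theorem eq_of_color_eq {α : Type*} {c : SatVtx n m → α} (hc : IsDefColoring (satGraph f) 1 c)
    {u v w : Fin n × Fin 4} (huv : u ≠ v) (huw : u ≠ w)
    (hv : c (Sum.inl v) = c (Sum.inl u)) (hw : c (Sum.inl w) = c (Sum.inl u)) : v = w :=
  Sum.inl_injective
    (hc.eq_of_adj (satGraph_adj_inl_inl f huv) (satGraph_adj_inl_inl f huw) hv hw)

theorem ncard_color_class_eq_two {c : SatVtx n m → Fin (2 * n)}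
    (hc : IsDefColoring (satGraph f) 1 c) (a : Fin (2 * n)) :
    {u : Fin n × Fin 4 | c (Sum.inl u) = a}.ncard = 2 := by
  rw [Set.ncard_eq_toFinset_card', Set.toFinset_ofPred]
  refine card_fiber_eq_of_le (by simp; ring) (fun b => ?_) a
  by_contra! hb
  obtain ⟨u, v, w, hu, hv, hw, huv, huw, hvw⟩ := Finset.two_lt_card_iff.1 hb
  simp only [Finset.mem_filter, Finset.mem_univ, true_and] at hu hv hw
  exact hvw (eq_of_color_eq hc huv huw (hv.trans hu.symm) (hw.trans hu.symm))

/-- The color of `z_i^k` is shared by two vertices of `U_i` other than `u_i^k`. -/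
theorem exists_monochromatic_pair {c : SatVtx n m → Fin (2 * n)}
    (hc : IsDefColoring (satGraph f) 1 c) (i : Fin n) (k : Fin 4) :
    ∃ p q : Fin 4, p ≠ q ∧ p ≠ k ∧ q ≠ k ∧ c (Sum.inl (i, p)) = c (Sum.inl (i, q)) := by
  obtain ⟨u, v, huv, hset⟩ :=
    Set.ncard_eq_two.1 (ncard_color_class_eq_two hc (c (Sum.inr (Sum.inl (i, k)))))
  have hu : c (Sum.inl u) = c (Sum.inr (Sum.inl (i, k))) :=
    hset.symm.subset (Set.mem_insert u {v})
  have hv : c (Sum.inl v) = c (Sum.inr (Sum.inl (i, k))) :=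
    hset.symm.subset (Set.mem_insert_of_mem u rfl)
  have not_adj : ∀ {x y : Fin n × Fin 4}, x ≠ y →
      c (Sum.inl x) = c (Sum.inr (Sum.inl (i, k))) →
      c (Sum.inl y) = c (Sum.inr (Sum.inl (i, k))) → x.1 = i ∧ x.2 ≠ k := by
    intro x y hxy hx hy
    by_contra h
    have hadj : x.1 ≠ i ∨ x.2 = k := by tauto
    exact Sum.inl_ne_inr (hc.eq_of_adj (satGraph_adj_inl_inl f hxy)
      (satGraph_adj_inl_inr_inl f hadj) (hy.trans hx.symm) hx.symm)
  obtain ⟨rfl, hp⟩ := not_adj huv hu hv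
  obtain ⟨hi, hq⟩ := not_adj huv.symm hv hu
  refine ⟨u.2, v.2, fun h => huv (Prod.ext hi.symm h), hp, hq, ?_⟩
  rw [show (u.1, v.2) = v from Prod.ext hi.symm rfl]
  exact hu.trans hv.symm

/-- Every clique vertex shares its color with another vertex of its quadruple. -/
theorem exists_ne_color_eq {c : SatVtx n m → Fin (2 * n)}
    (hc : IsDefColoring (satGraph f) 1 c) (i : Fin n) (k : Fin 4) :
    ∃ l : Fin 4, l ≠ k ∧ c (Sum.inl (i, l)) = c (Sum.inl (i, k)) := by
  obtain ⟨p, q, hpq, hpk, hqk, hpqc⟩ := exists_monochromatic_pair hc i k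
  obtain ⟨r, s, hrs, hrp, hsp, hrsc⟩ := exists_monochromatic_pair hc i p
  have key : ∀ {x y : Fin 4}, x ≠ y → x ≠ p → y ≠ p →
      c (Sum.inl (i, x)) = c (Sum.inl (i, y)) → x ≠ q := by
    rintro x y hxy hxp hyp h rfl
    exact hyp (congrArg Prod.snd (eq_of_color_eq hc (u := (i, x)) (v := (i, y)) (w := (i, p))
      (by simpa using hxy) (by simpa using hxp) h.symm hpqc))
  have hrq := key hrs hrp hsp hrsc
  have hsq := key hrs.symm hsp hrp hrsc.symm
  obtain rfl | rfl : r = k ∨ s = k := by omega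
  · exact ⟨s, hrs.symm, hrsc.symm⟩
  · exact ⟨r, hrs, hrsc⟩

end Coloring

/-- In any `(2n,1)`-coloring of `G(f)`, every color class contains exactly two clique
vertices, and any two clique vertices with the same color lie in the same quadruple
`U_i`. -/
theorem stmt14 {n m : ℕ} (f : CNF3 n m)
    (c : SatVtx n m → Fin (2 * n)) (hc : IsDefColoring (satGraph f) 1 c) :
    (∀ a : Fin (2 * n), {u : Fin n × Fin 4 | c (Sum.inl u) = a}.ncard = 2) ∧
    (∀ (i i' : Fin n) (k k' : Fin 4),
      c (Sum.inl (i, k)) = c (Sum.inl (i', k')) → i = i') := by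
  refine ⟨ncard_color_class_eq_two hc, fun i i' k k' h => ?_⟩
  by_contra hi
  obtain ⟨l, hlk, hl⟩ := exists_ne_color_eq hc i k
  exact hi (congrArg Prod.fst (eq_of_color_eq hc (u := (i, k)) (v := (i, l)) (w := (i', k'))
    (by simpa using hlk.symm) (by simp [hi]) hl h.symm))
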